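/- For every n ≥ 1 the numerical radius of the Fourier projection F_n : C(2π) → Π_n satisfies (4/π²) ln(n) ≤ ‖F_n‖_w ≤ ln(n) + 3. -/

import Mathlib

open MeasureTheory
open scoped Real ENNReal

instance : Fact (0 < 2 * π) := ⟨by positivity⟩

/-- `C(2π)`: continuous `2π`-periodic real-valued functions with the sup norm. -/
abbrev C2pi : Type := C(AddCircle (2 * π), ℝ)

/-- `cos (k t)` as an element of `C(2π)`. -/
noncomputable def cosF (k : ℕ) : C2pi :=
  ⟨fun t => (fourier (T := 2 * π) k t).re, (Complex.continuous_re.comp (map_continuous _))⟩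

/-- `sin (k t)` as an element of `C(2π)`. -/
noncomputable def sinF (k : ℕ) : C2pi :=
  ⟨fun t => (fourier (T := 2 * π) k t).im, (Complex.continuous_im.comp (map_continuous _))⟩

/-- `Π_n`: the space of trigonometric polynomials of degree at most `n`. -/
noncomputable def trigPoly (n : ℕ) : Submodule ℝ C2pi :=
  Submodule.span ℝ {f : C2pi | ∃ k : ℕ, k ≤ n ∧ (f = cosF k ∨ f = sinF k)}

/-- The `L²`-inner-product coefficient functional `f ↦ ∫₀^{2π} f(t) g(t) dt`. -/
noncomputable def coeffCLM (g : C2pi) : C2pi →L[ℝ] ℝ :=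
  (innerSL ℝ (ContinuousMap.toLp (E := ℝ) 2 volume ℝ g)).comp
    (ContinuousMap.toLp (E := ℝ) 2 volume ℝ)

/-- The Fourier projection `F_n : C(2π) → Π_n`, sending `f` to its `n`-th Fourier
partial sum. -/
noncomputable def fourierProj (n : ℕ) : C2pi →L[ℝ] C2pi :=
  (1 / (2 * π)) • (coeffCLM (cosF 0)).smulRight (cosF 0) +
    ∑ k ∈ Finset.Icc 1 n,
      ((1 / π) • ((coeffCLM (cosF k)).smulRight (cosF k) +
        (coeffCLM (sinF k)).smulRight (sinF k)))

/-- Translation operator `(T_g f)(t) = f(t + g)` on `C(2π)`. -/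
noncomputable def translateBy (g : ℝ) (f : C2pi) : C2pi :=
  f.comp ⟨fun t => t + (g : AddCircle (2 * π)), by continuity⟩

/-- The numerical radius of a bounded linear operator `S` on a normed space `X`:
`‖S‖_w = sup {|x*(Sx)| : ‖x‖ = ‖x*‖ = 1, x*(x) = 1}`. -/
noncomputable def numericalRadius (X : Type*) [NormedAddCommGroup X]
    [NormedSpace ℝ X] (S : X →L[ℝ] X) : ℝ :=
  sSup {r : ℝ | ∃ (x : X) (f : X →L[ℝ] ℝ), ‖x‖ = 1 ∧ ‖f‖ = 1 ∧ f x = 1 ∧ r = ‖f (S x)‖}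

theorem cosF_coe (k : ℕ) (x : ℝ) : cosF k (x : AddCircle (2 * π)) = Real.cos (k * x) := by
  have h : (2 * π * Complex.I * (k : ℤ) * x / (2 * π : ℝ) : ℂ) = ((k * x : ℝ) : ℂ) * Complex.I := by
    have : (π : ℂ) ≠ 0 := by exact_mod_cast Real.pi_ne_zero
    push_cast
    field_simp
  change (fourier (T := 2 * π) k (x : AddCircle (2 * π))).re = _
  rw [fourier_coe_apply, h, Complex.exp_ofReal_mul_I_re]

theorem sinF_coe (k : ℕ) (x : ℝ) : sinF k (x : AddCircle (2 * π)) = Real.sin (k * x) := by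
  have h : (2 * π * Complex.I * (k : ℤ) * x / (2 * π : ℝ) : ℂ) = ((k * x : ℝ) : ℂ) * Complex.I := by
    have : (π : ℂ) ≠ 0 := by exact_mod_cast Real.pi_ne_zero
    push_cast
    field_simp
  change (fourier (T := 2 * π) k (x : AddCircle (2 * π))).im = _
  rw [fourier_coe_apply, h, Complex.exp_ofReal_mul_I_im]

theorem cosF_sub (k : ℕ) (x t : AddCircle (2 * π)) :
    cosF k (x - t) = cosF k x * cosF k t + sinF k x * sinF k t := by
  induction x using QuotientAddGroup.induction_on with | _ x
  induction t using QuotientAddGroup.induction_on with | _ t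
  rw [← QuotientAddGroup.mk_sub]
  simp only [cosF_coe, sinF_coe]
  rw [mul_sub, Real.cos_sub]

theorem coeffCLM_apply (g f : C2pi) : coeffCLM g f = ∫ t, f t * g t := by
  simpa [coeffCLM] using
    ContinuousMap.inner_toLp (volume : Measure (AddCircle (2 * π))) (𝕜 := ℝ) g f

/-- The Dirichlet kernel `1 + 2 ∑_{k=1}^n cos (k t)` as an element of `C(2π)`. -/
noncomputable def dirichletKernel (n : ℕ) : C2pi :=
  cosF 0 + ∑ k ∈ Finset.Icc 1 n, (2 : ℝ) • cosF k

/-- The Lebesgue constant `(1 / 2π) ∫ |D_n|`. -/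
noncomputable def lebesgueConst (n : ℕ) : ℝ :=
  1 / (2 * π) * ∫ t, |dirichletKernel n t|

theorem dirichletKernel_coe (n : ℕ) (x : ℝ) :
    dirichletKernel n (x : AddCircle (2 * π)) =
      1 + ∑ k ∈ Finset.Icc 1 n, 2 * Real.cos (k * x) := by
  simp [dirichletKernel, cosF_coe]

theorem integrable_of_continuous {f : AddCircle (2 * π) → ℝ} (hf : Continuous f) :
    Integrable f :=
  hf.integrable_of_hasCompactSupport (HasCompactSupport.of_compactSpace f)

theorem fourierProj_apply (n : ℕ) (f : C2pi) (x : AddCircle (2 * π)) :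
    fourierProj n f x = 1 / (2 * π) * ∫ t, f t * dirichletKernel n (x - t) := by
  have hint : ∀ g : C2pi, Integrable fun t => f t * g t := fun g =>
    integrable_of_continuous (by fun_prop)
  have hcos : ∀ k, (∫ t, f t * cosF k (x - t)) =
      coeffCLM (cosF k) f * cosF k x + coeffCLM (sinF k) f * sinF k x := by
    intro k
    rw [coeffCLM_apply, coeffCLM_apply, ← integral_mul_const, ← integral_mul_const,
      ← integral_add ((hint _).mul_const _) ((hint _).mul_const _)]
    refine integral_congr_ae (.of_forall fun t => ?_)
    simp only [cosF_sub]
    ring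
  have hsin : sinF 0 x = 0 := by
    induction x using QuotientAddGroup.induction_on with | _ x
    rw [sinF_coe]
    simp
  have hI : (∫ t, f t * dirichletKernel n (x - t)) = (∫ t, f t * cosF 0 (x - t)) +
      ∑ k ∈ Finset.Icc 1 n, 2 * ∫ t, f t * cosF k (x - t) := by
    have hc : ∀ k, Integrable fun t => f t * cosF k (x - t) := fun k =>
      integrable_of_continuous (by fun_prop)
    simp_rw [← integral_const_mul]
    rw [← integral_finsetSum _ fun k _ => (hc k).const_mul 2,
      ← integral_add (hc 0) (integrable_finsetSum _ fun k _ => (hc k).const_mul 2)]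
    refine integral_congr_ae (.of_forall fun t => ?_)
    simp only [dirichletKernel, ContinuousMap.add_apply, ContinuousMap.sum_apply,
      ContinuousMap.smul_apply, smul_eq_mul, mul_add, Finset.mul_sum]
    congr 1
    exact Finset.sum_congr rfl fun k _ => by ring
  rw [hI, hcos 0, hsin]
  simp only [hcos, fourierProj, _root_.add_apply, _root_.sum_apply,
    _root_.smul_apply, ContinuousLinearMap.smulRight_apply,
    ContinuousMap.add_apply, ContinuousMap.sum_apply, ContinuousMap.smul_apply, smul_eq_mul,
    mul_add, Finset.mul_sum, mul_zero, add_zero]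
  congr 1
  refine Finset.sum_congr rfl fun k _ => ?_
  have := Real.pi_ne_zero
  field_simp

theorem norm_fourierProj_apply_le (n : ℕ) (f : C2pi) :
    ‖fourierProj n f‖ ≤ lebesgueConst n * ‖f‖ := by
  have hL : 0 ≤ lebesgueConst n := by
    unfold lebesgueConst
    positivity
  refine (ContinuousMap.norm_le _ (by positivity)).2 fun x => ?_
  have hπ := Real.pi_pos
  have h1 : ‖∫ t, f t * dirichletKernel n (x - t)‖ ≤ ∫ t, ‖f‖ * |dirichletKernel n (x - t)| := by
    refine norm_integral_le_of_norm_le (integrable_of_continuous (by fun_prop))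
      (.of_forall fun t => ?_)
    rw [norm_mul, Real.norm_eq_abs (dirichletKernel n (x - t))]
    gcongr
    exact f.norm_coe_le_norm t
  rw [integral_const_mul,
    integral_sub_left_eq_self (fun t => |dirichletKernel n t|) volume x] at h1
  rw [fourierProj_apply, norm_mul, Real.norm_of_nonneg (by positivity), lebesgueConst, mul_assoc]
  gcongr
  linarith

theorem dirichletKernel_zero (n : ℕ) : dirichletKernel n 0 = 2 * n + 1 := by
  rw [← QuotientAddGroup.mk_zero]
  refine (dirichletKernel_coe n 0).trans ?_
  simp
  ring

theorem abs_dirichletKernel_le (n : ℕ) (t : AddCircle (2 * π)) :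
    |dirichletKernel n t| ≤ 2 * n + 1 := by
  induction t using QuotientAddGroup.induction_on with | _ t
  refine (congrArg abs (dirichletKernel_coe n t)).trans_le ?_
  calc _ ≤ |(1 : ℝ)| + ∑ k ∈ Finset.Icc 1 n, |2 * Real.cos (k * t)| :=
        (abs_add_le _ _).trans (by gcongr; exact Finset.abs_sum_le_sum_abs _ _)
    _ ≤ |(1 : ℝ)| + ∑ k ∈ Finset.Icc 1 n, 2 := by
        gcongr with k
        rw [abs_mul, abs_two]
        linarith [Real.abs_cos_le_one (k * t)]
    _ = _ := by
        simp
        ring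

theorem dirichletKernel_neg (n : ℕ) (t : AddCircle (2 * π)) :
    dirichletKernel n (-t) = dirichletKernel n t := by
  induction t using QuotientAddGroup.induction_on with | _ t
  rw [← QuotientAddGroup.mk_neg]
  refine (dirichletKernel_coe n _).trans (Eq.trans ?_ (dirichletKernel_coe n _).symm)
  simp

theorem sin_half_mul_dirichletKernel (n : ℕ) (t : ℝ) :
    Real.sin (t / 2) * dirichletKernel n (t : AddCircle (2 * π)) =
      Real.sin ((n + 1 / 2) * t) := by
  rw [dirichletKernel_coe]
  induction n with
  | zero => simp [div_eq_inv_mul]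
  | succ n ih =>
    rw [Finset.sum_Icc_succ_top (by omega), ← add_assoc, mul_add, ih]
    have h1 : ((n : ℝ) + 1 / 2) * t = ((n + 1 : ℕ) : ℝ) * t - t / 2 := by push_cast; ring
    have h2 : (((n + 1 : ℕ) : ℝ) + 1 / 2) * t = ((n + 1 : ℕ) : ℝ) * t + t / 2 := by
      push_cast; ring
    rw [h1, h2, Real.sin_sub, Real.sin_add]
    ring

theorem lebesgueConst_eq (n : ℕ) :
    lebesgueConst n = 1 / π * ∫ t in (0 : ℝ)..π, |dirichletKernel n (t : AddCircle (2 * π))| := by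
  have hc : Continuous fun t : ℝ => |dirichletKernel n (t : AddCircle (2 * π))| :=
    ((dirichletKernel n).continuous.comp (AddCircle.continuous_mk' _)).abs
  have h := AddCircle.intervalIntegral_preimage (2 * π) (-π) fun t => |dirichletKernel n t|
  have hneg := intervalIntegral.integral_comp_neg (a := 0) (b := π)
    fun t : ℝ => |dirichletKernel n (t : AddCircle (2 * π))|
  simp only [AddCircle.coe_neg, dirichletKernel_neg, neg_zero] at hneg
  rw [show -π + 2 * π = π by ring, ← intervalIntegral.integral_add_adjacent_intervals
    (hc.intervalIntegrable (-π) 0) (hc.intervalIntegrable 0 π), ← hneg] at h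
  rw [lebesgueConst, ← h]
  have := Real.pi_ne_zero
  field_simp
  ring

theorem lebesgueConst_le (n : ℕ) (hn : 1 ≤ n) : lebesgueConst n ≤ Real.log n + 3 := by
  have hπ := Real.pi_pos
  have hn' : (1 : ℝ) ≤ n := by exact_mod_cast hn
  have hn0 : (0 : ℝ) < n := by linarith
  have hδ : (1 : ℝ) / n ≤ π := by
    have : (1 : ℝ) / n ≤ 1 := by rw [div_le_one hn0]; exact hn'
    linarith [Real.pi_gt_three]
  have hδ0 : (0 : ℝ) < 1 / n := by positivity
  have hc : Continuous fun t : ℝ => |dirichletKernel n (t : AddCircle (2 * π))| :=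
    ((dirichletKernel n).continuous.comp (AddCircle.continuous_mk' _)).abs
  rw [lebesgueConst_eq, ← intervalIntegral.integral_add_adjacent_intervals
    (hc.intervalIntegrable 0 (1 / n)) (hc.intervalIntegrable (1 / n) π)]
  have h1 : (∫ t in (0 : ℝ)..1 / n, |dirichletKernel n (t : AddCircle (2 * π))|) ≤ 3 := by
    calc _ ≤ ∫ t in (0 : ℝ)..1 / n, (2 * n + 1 : ℝ) :=
          intervalIntegral.integral_mono_on hδ0.le (hc.intervalIntegrable _ _) (by simp)
            fun t _ => abs_dirichletKernel_le n t
      _ = 2 + 1 / n := by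
          simp
          field_simp
      _ ≤ 3 := by
          have : (1 : ℝ) / n ≤ 1 := by rw [div_le_one hn0]; exact hn'
          linarith
  have h2 : (∫ t in (1 / n : ℝ)..π, |dirichletKernel n (t : AddCircle (2 * π))|) ≤
      π * (Real.log π + Real.log n) := by
    have hii : IntervalIntegrable (fun t : ℝ => π * (1 / t)) volume (1 / n) π := by
      refine ContinuousOn.intervalIntegrable_of_Icc hδ ?_
      exact continuousOn_const.mul (continuousOn_const.div continuousOn_id
        fun t ht => (hδ0.trans_le ht.1).ne')
    calc _ ≤ ∫ t in (1 / n : ℝ)..π, π * (1 / t) := by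
          refine intervalIntegral.integral_mono_on hδ (hc.intervalIntegrable _ _) hii
            fun t ht => ?_
          have ht0 : 0 < t := hδ0.trans_le ht.1
          have hs : t / π ≤ Real.sin (t / 2) := by
            have := Real.mul_le_sin (x := t / 2) (by linarith) (by linarith [ht.2])
            calc t / π = 2 / π * (t / 2) := by ring
              _ ≤ _ := this
          have hD := congrArg abs (sin_half_mul_dirichletKernel n t)
          rw [abs_mul] at hD
          have hD' : t / π * |dirichletKernel n (t : AddCircle (2 * π))| ≤ 1 := by
            calc _ ≤ |Real.sin (t / 2)| * |dirichletKernel n (t : AddCircle (2 * π))| := by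
                  gcongr
                  exact hs.trans (le_abs_self _)
              _ ≤ 1 := hD.trans_le (Real.abs_sin_le_one _)
          rw [mul_one_div, le_div_iff₀ ht0]
          rw [div_mul_eq_mul_div, div_le_one hπ] at hD'
          linarith
      _ = _ := by
          rw [intervalIntegral.integral_const_mul, integral_one_div_of_pos hδ0 hπ,
            div_div_eq_mul_div, div_one, Real.log_mul hπ.ne' hn0.ne']
  have hlog : Real.log π ≤ 2 := by
    rw [Real.log_le_iff_le_exp hπ]
    have : Real.exp 2 = Real.exp 1 * Real.exp 1 := by rw [← Real.exp_add]; norm_num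
    rw [this]
    nlinarith [Real.exp_one_gt_d9, Real.pi_lt_d2]
  calc _ ≤ 1 / π * (3 + π * (Real.log π + Real.log n)) := by gcongr
    _ = 3 / π + Real.log π + Real.log n := by field_simp; ring
    _ ≤ _ := by
      have : 3 / π ≤ 1 := by rw [div_le_one hπ]; exact Real.pi_gt_three.le
      linarith

theorem two_div_le_integral_abs_sin {a : ℝ} (ha : 0 < a) (k : ℕ) :
    2 / a ≤ ∫ t in (k * (π / a))..((k + 1 : ℕ) * (π / a)), |Real.sin (a * t)| := by
  rw [intervalIntegral.integral_comp_mul_left (fun u => |Real.sin u|) ha.ne',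
    show a * (k * (π / a)) = k * π by field_simp,
    show a * ((k + 1 : ℕ) * (π / a)) = k * π + π by push_cast; field_simp]
  have hp : Function.Periodic (fun u => |Real.sin u|) π := fun u => by
    simp [Real.sin_add_pi]
  rw [hp.intervalIntegral_add_eq (k * π) 0, zero_add]
  have : ∫ u in (0 : ℝ)..π, |Real.sin u| = ∫ u in (0 : ℝ)..π, Real.sin u := by
    refine intervalIntegral.integral_congr fun u hu => ?_
    rw [Set.uIcc_of_le Real.pi_pos.le] at hu
    exact abs_of_nonneg (Real.sin_nonneg_of_mem_Icc hu)
  rw [this, integral_sin]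
  simp
  ring_nf
  rfl

theorem le_lebesgueConst (n : ℕ) (hn : 1 ≤ n) : 4 / π ^ 2 * Real.log n ≤ lebesgueConst n := by
  have hπ := Real.pi_pos
  set a : ℝ := n + 1 / 2 with ha
  have ha0 : 0 < a := by positivity
  have hc : Continuous fun t : ℝ => |dirichletKernel n (t : AddCircle (2 * π))| :=
    ((dirichletKernel n).continuous.comp (AddCircle.continuous_mk' _)).abs
  have hstep : ∀ k : ℕ, 4 / π * (1 / ((k : ℝ) + 1)) ≤
      ∫ t in (k * (π / a))..((k + 1 : ℕ) * (π / a)),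
        |dirichletKernel n (t : AddCircle (2 * π))| := by
    intro k
    have hle : (k : ℝ) * (π / a) ≤ ((k + 1 : ℕ) : ℝ) * (π / a) := by
      gcongr
      simp
    calc 4 / π * (1 / ((k : ℝ) + 1)) = 2 / (((k + 1 : ℕ) : ℝ) * (π / a)) * (2 / a) := by
          push_cast
          field_simp
          norm_num
      _ ≤ 2 / (((k + 1 : ℕ) : ℝ) * (π / a)) *
          ∫ t in (k * (π / a))..((k + 1 : ℕ) * (π / a)), |Real.sin (a * t)| := by
          gcongr
          exact two_div_le_integral_abs_sin ha0 k
      _ = ∫ t in (k * (π / a))..((k + 1 : ℕ) * (π / a)),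
          2 / (((k + 1 : ℕ) : ℝ) * (π / a)) * |Real.sin (a * t)| := by
          rw [intervalIntegral.integral_const_mul]
      _ ≤ _ := by
          refine intervalIntegral.integral_mono_on hle
            (Continuous.intervalIntegrable (by fun_prop) _ _) (hc.intervalIntegrable _ _)
            fun t ht => ?_
          have ht0 : 0 ≤ t := le_trans (by positivity) ht.1
          have hT : 0 < ((k + 1 : ℕ) : ℝ) * (π / a) := by positivity
          have hs : |Real.sin (t / 2)| ≤ ((k + 1 : ℕ) : ℝ) * (π / a) / 2 := by
            refine Real.abs_sin_le_abs.trans ?_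
            rw [abs_of_nonneg (by linarith)]
            linarith [ht.2]
          rw [div_mul_eq_mul_div, div_le_iff₀ hT, ha, ← sin_half_mul_dirichletKernel, abs_mul,
            ← ha]
          nlinarith [mul_le_mul_of_nonneg_right hs
            (abs_nonneg (dirichletKernel n (t : AddCircle (2 * π))))]
  have hsum : ∑ k ∈ Finset.range n, 4 / π * (1 / ((k : ℝ) + 1)) ≤
      ∫ t in (0 : ℝ)..π, |dirichletKernel n (t : AddCircle (2 * π))| := by
    refine (Finset.sum_le_sum fun k _ => hstep k).trans ?_
    rw [intervalIntegral.sum_integral_adjacent_intervals (a := fun k : ℕ => (k : ℝ) * (π / a))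
      fun k _ => hc.intervalIntegrable _ _]
    refine intervalIntegral.integral_mono_interval (by simp)
      (by simpa using (by positivity : 0 ≤ (n : ℝ) * (π / a))) ?_
      (.of_forall fun t => abs_nonneg _) (hc.intervalIntegrable _ _)
    rw [mul_div_assoc', div_le_iff₀ ha0, mul_comm]
    gcongr
    simp [ha]
  have hlog : Real.log n ≤ ∑ k ∈ Finset.range n, 1 / ((k : ℝ) + 1) := by
    have h := log_add_one_le_harmonic n
    have h' : Real.log n ≤ Real.log ((n + 1 : ℕ) : ℝ) := by
      have : (0 : ℝ) < n := by exact_mod_cast hn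
      gcongr
      simp
    refine (h'.trans h).trans_eq ?_
    simp [harmonic]
  rw [lebesgueConst_eq]
  rw [← Finset.mul_sum] at hsum
  calc 4 / π ^ 2 * Real.log n = 1 / π * (4 / π * Real.log n) := by ring
    _ ≤ 1 / π * (4 / π * ∑ k ∈ Finset.range n, 1 / ((k : ℝ) + 1)) := by gcongr
    _ ≤ _ := by gcongr

theorem norm_evalCLM_eq_one (x : AddCircle (2 * π)) :
    ‖(ContinuousMap.evalCLM ℝ x : C2pi →L[ℝ] ℝ)‖ = 1 := by
  refine le_antisymm (ContinuousLinearMap.opNorm_le_bound _ zero_le_one fun f => ?_) ?_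
  · rw [one_mul]
    exact f.norm_coe_le_norm x
  · simpa using (ContinuousMap.evalCLM ℝ x : C2pi →L[ℝ] ℝ).le_opNorm 1

theorem norm_apply_le_lebesgueConst (n : ℕ) {x : C2pi} {f : C2pi →L[ℝ] ℝ} (hx : ‖x‖ = 1)
    (hf : ‖f‖ = 1) : ‖f (fourierProj n x)‖ ≤ lebesgueConst n := by
  have h1 := f.le_opNorm (fourierProj n x)
  have h2 := norm_fourierProj_apply_le n x
  rw [hf, one_mul] at h1
  rw [hx, mul_one] at h2
  exact h1.trans h2

/-- A continuous approximation of the sign of the Dirichlet kernel, of norm one and equal to one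
at the origin, nearly attains the Lebesgue constant. -/
theorem exists_fourierProj_apply_zero_ge (n : ℕ) {ε : ℝ} (hε : 0 < ε) :
    ∃ x : C2pi, ‖x‖ = 1 ∧ x 0 = 1 ∧ lebesgueConst n - ε ≤ fourierProj n x 0 := by
  set D := dirichletKernel n with hD
  set N : ℝ := 2 * n + 1 with hN
  have hN0 : 0 < N := by positivity
  have hpos : ∀ t, 0 < |D t| + ε := fun t => by positivity
  let x : C2pi := ⟨fun t => (N + ε) / N * (D t / (|D t| + ε)),
    continuous_const.mul (D.continuous.div (by fun_prop) fun t => (hpos t).ne')⟩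
  have hx : ∀ t, x t = (N + ε) / N * (D t / (|D t| + ε)) := fun _ => rfl
  have hx0 : x 0 = 1 := by
    rw [hx, hD, dirichletKernel_zero, ← hN, abs_of_pos hN0]
    have : N + ε ≠ 0 := by positivity
    field_simp
  have hxle : ‖x‖ ≤ 1 := by
    refine (ContinuousMap.norm_le _ zero_le_one).2 fun t => ?_
    rw [hx, Real.norm_eq_abs, abs_mul, abs_div (D t), abs_of_pos (hpos t),
      abs_of_pos (by positivity : 0 < (N + ε) / N), div_mul_div_comm,
      div_le_one (mul_pos hN0 (hpos t))]
    have : |D t| ≤ N := abs_dirichletKernel_le n t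
    nlinarith
  have hxge : 1 ≤ ‖x‖ := by
    have := x.norm_coe_le_norm 0
    rwa [hx0, norm_one] at this
  refine ⟨x, le_antisymm hxle hxge, hx0, ?_⟩
  have hint : (∫ t, (|D t| - ε)) ≤ ∫ t, x t * D (0 - t) := by
    refine integral_mono (integrable_of_continuous (by fun_prop))
      (integrable_of_continuous (by fun_prop)) fun t => ?_
    simp only [zero_sub]
    rw [hD, dirichletKernel_neg, ← hD, hx]
    have h1 : |D t| - ε ≤ D t / (|D t| + ε) * D t := by
      rw [div_mul_eq_mul_div, le_div_iff₀ (hpos t)]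
      nlinarith [abs_mul_abs_self (D t)]
    have h2 : 0 ≤ D t / (|D t| + ε) * D t := by
      rw [div_mul_eq_mul_div]
      exact div_nonneg (mul_self_nonneg _) (hpos t).le
    have h3 : 1 ≤ (N + ε) / N := by
      rw [le_div_iff₀ hN0]
      linarith
    rw [mul_assoc]
    nlinarith
  have hπ := Real.pi_pos
  have hvol : (∫ _ : AddCircle (2 * π), ε) = 2 * π * ε := by
    rw [integral_const]
    simp [Measure.real, AddCircle.measure_univ, hπ.le]
  rw [integral_sub (integrable_of_continuous (by fun_prop))
    (integrable_of_continuous continuous_const), hvol] at hint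
  calc lebesgueConst n - ε = 1 / (2 * π) * ((∫ t, |D t|) - 2 * π * ε) := by
        rw [lebesgueConst, ← hD]
        field_simp
    _ ≤ 1 / (2 * π) * ∫ t, x t * D (0 - t) := by gcongr
    _ = _ := (fourierProj_apply n x 0).symm

theorem numericalRadius_fourierProj (n : ℕ) :
    numericalRadius C2pi (fourierProj n) = lebesgueConst n := by
  refine le_antisymm (Real.sSup_le ?_ (by unfold lebesgueConst; positivity)) ?_
  · rintro r ⟨x, f, hx, hf, -, rfl⟩
    exact norm_apply_le_lebesgueConst n hx hf
  · refine le_of_forall_pos_sub_le fun ε hε => ?_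
    obtain ⟨x, hx, hx0, h⟩ := exists_fourierProj_apply_zero_ge n hε
    refine (h.trans (le_abs_self _)).trans (le_csSup ⟨lebesgueConst n, ?_⟩
      ⟨x, ContinuousMap.evalCLM ℝ 0, hx, norm_evalCLM_eq_one 0, hx0, rfl⟩)
    rintro r ⟨x, f, hx, hf, -, rfl⟩
    exact norm_apply_le_lebesgueConst n hx hf

/-- For `n ≥ 1`, the numerical radius of the Fourier projection `F_n` satisfies
`(4/π²) ln n ≤ ‖F_n‖_w ≤ ln n + 3`. -/
theorem fourierProj_numericalRadius_bounds (n : ℕ) (hn : 1 ≤ n) :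
    (4 / π ^ 2) * Real.log n ≤ numericalRadius C2pi (fourierProj n) ∧
      numericalRadius C2pi (fourierProj n) ≤ Real.log n + 3 := by
  rw [numericalRadius_fourierProj]
  exact ⟨le_lebesgueConst n hn, lebesgueConst_le n hn⟩
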